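/- Let R be a 2-dimensional regular local ring containing ℂ with residue field ℂ, with maximal ideal m, A = R[t]/(t²), and I = (t) ⊆ A. Then the balanced finitely generated A-modules M satisfying M ⊗_A R ≅ m (equivalently M/tM ≅ m as R-modules) are exactly the A-modules isomorphic to ideals J ⊆ A admitting two generators x, y whose images x₀, y₀ in R generate m. That is: every such ideal J is balanced with J/tJ ≅ m, and conversely every finitely generated balanced A-module M with M/tM ≅ m is isomorphic to such an ideal. -/

import Mathlib

open Polynomial

noncomputable section

/-- The primitive multiple ring `R[n] = R[t]/(t^n)`. -/
abbrev Rn (R : Type*) [CommRing R] (n : ℕ) : Type _ :=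
  Polynomial R ⧸ Ideal.span {(X : Polynomial R) ^ n}

/-- The class `t` of the variable in `R[n]`. -/
def tn (R : Type*) [CommRing R] (n : ℕ) : Rn R n :=
  Ideal.Quotient.mk _ X

/-- `R[k] = R[n]/(t^k)` as an `R[n]`-module (for `k ≤ n` this is `R[t]/(t^k)`
with the `R[n]`-module structure coming from the natural surjection `R[n] → R[k]`). -/
abbrev Rmod (R : Type*) [CommRing R] (n k : ℕ) : Type _ :=
  Rn R n ⧸ (Ideal.span {tn R n ^ k})

/-- The constant term homomorphism `R[n] → R` (for `n > 0`). -/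
def ct (R : Type*) [CommRing R] (n : ℕ) (hn : 0 < n) : Rn R n →+* R :=
  Ideal.Quotient.lift _ (evalRingHom 0) (by
    intro a ha
    rw [Ideal.mem_span_singleton] at ha
    obtain ⟨c, rfl⟩ := ha
    simp [zero_pow hn.ne'])

section Modules

variable (R : Type*) [CommRing R] (n : ℕ) (M : Type*) [AddCommGroup M] [Module (Rn R n) M]

/-- The submodule `M_i = t^i M` of an `R[n]`-module `M`. -/
def tMi (i : ℕ) : Submodule (Rn R n) M :=
  LinearMap.range (LinearMap.lsmul (Rn R n) M (tn R n ^ i))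

/-- The submodule `M^{(i)} = {m ∈ M : t^i m = 0}` of an `R[n]`-module `M`. -/
def kt (i : ℕ) : Submodule (Rn R n) M :=
  LinearMap.ker (LinearMap.lsmul (Rn R n) M (tn R n ^ i))

/-- `G_i(M) = t^i M / t^{i+1} M`. -/
abbrev Gi (i : ℕ) :=
  (tMi R n M i) ⧸ (Submodule.comap (tMi R n M i).subtype (tMi R n M (i + 1)))

/-- `G^{(i+1)}(M) = M^{(i+1)}/M^{(i)}` (note the shift by one in the indexing:
`Gup R n M i` is `G^{(i+1)}(M)`). -/
abbrev Gup (i : ℕ) :=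
  (kt R n M (i + 1)) ⧸ (Submodule.comap (kt R n M (i + 1)).subtype (kt R n M i))

lemma tMi_succ_mem {i : ℕ} {x : M} (hx : x ∈ tMi R n M i) :
    tn R n • x ∈ tMi R n M (i + 1) := by
  obtain ⟨m, rfl⟩ := hx
  exact ⟨m, by simp [LinearMap.lsmul_apply, smul_smul, pow_succ']⟩

lemma kt_pred_mem {i : ℕ} {x : M} (hx : x ∈ kt R n M (i + 1)) :
    tn R n • x ∈ kt R n M i := by
  simp only [kt, LinearMap.mem_ker, LinearMap.lsmul_apply] at hx ⊢
  rw [smul_smul, ← pow_succ]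
  exact hx

/-- `μ_i : G_i(M) → G_{i+1}(M)`, induced by multiplication by `t`. -/
def muMap (i : ℕ) : Gi R n M i →ₗ[Rn R n] Gi R n M (i + 1) :=
  Submodule.mapQ _ _
    (LinearMap.restrict (LinearMap.lsmul (Rn R n) M (tn R n))
      (fun _ hx => tMi_succ_mem R n M hx))
    (fun x hx => by
      simp only [Submodule.mem_comap] at hx ⊢
      exact tMi_succ_mem R n M hx)

/-- `λ_{i+1} : G^{(i+2)}(M) → G^{(i+1)}(M)`, induced by multiplication by `t`
(with the shifted indexing, `lamMap R n M i : Gup (i+1) → Gup i`). -/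
def lamMap (i : ℕ) : Gup R n M (i + 1) →ₗ[Rn R n] Gup R n M i :=
  Submodule.mapQ _ _
    (LinearMap.restrict (LinearMap.lsmul (Rn R n) M (tn R n))
      (fun _ hx => kt_pred_mem R n M hx))
    (fun x hx => by
      simp only [Submodule.mem_comap] at hx ⊢
      exact kt_pred_mem R n M hx)

/-- The composition `μ_{k-1} ∘ ... ∘ μ_0 : G_0(M) → G_k(M)`. -/
def muComp : (k : ℕ) → (Gi R n M 0 →ₗ[Rn R n] Gi R n M k)
  | 0 => LinearMap.id
  | (k + 1) => (muMap R n M k).comp (muComp k)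

/-- The composition `λ_1 ∘ ... ∘ λ_k : G^{(k+1)}(M) → G^{(1)}(M)`. -/
def lamComp : (k : ℕ) → (Gup R n M k →ₗ[Rn R n] Gup R n M 0)
  | 0 => LinearMap.id
  | (k + 1) => (lamComp k).comp (lamMap R n M k)

end Modules

section DoubleLocal

/-- The constant term homomorphism `A = R[2] → R`. -/
def ct2 (R : Type*) [CommRing R] : Rn R 2 →+* R := ct R 2 (by norm_num)

/-- The ideal `I = (t) ⊆ A = R[2]` (the ideal of `X ⊆ X₂` at the point). -/
def It (R : Type*) [CommRing R] : Ideal (Rn R 2) := Ideal.span {tn R 2}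

/-- The ideal `𝔪I ⊆ A = R[2]`. -/
def mIt (R : Type*) [CommRing R] [IsLocalRing R] : Ideal (Rn R 2) :=
  Ideal.map (algebraMap R (Rn R 2)) (IsLocalRing.maximalIdeal R) * It R

/-- The ideal `𝔪²I ⊆ A = R[2]`. -/
def m2It (R : Type*) [CommRing R] [IsLocalRing R] : Ideal (Rn R 2) :=
  (Ideal.map (algebraMap R (Rn R 2)) (IsLocalRing.maximalIdeal R)) ^ 2 * It R

end DoubleLocal

universe u v

section RegularParameters

variable {R : Type*} [CommRing R] [IsLocalRing R] [IsNoetherianRing R]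

lemma maximalIdeal_notMem_minimalPrimes_span_singleton (hdim : ringKrullDim R = 2) (x : R) :
    IsLocalRing.maximalIdeal R ∉ (Ideal.span {x}).minimalPrimes := by
  intro h
  have h1 := Ideal.height_le_one_of_isPrincipal_of_mem_minimalPrimes _ _ h
  have h2 : ((IsLocalRing.maximalIdeal R).height : WithBot ℕ∞) = 2 := by
    rw [IsLocalRing.maximalIdeal_height_eq_ringKrullDim, hdim]
  have h3 : (IsLocalRing.maximalIdeal R).height = 2 := WithBot.coe_injective h2
  rw [h3] at h1
  exact absurd h1 (by decide)

lemma maximalIdeal_ne_span_singleton (hdim : ringKrullDim R = 2) (x : R) :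
    IsLocalRing.maximalIdeal R ≠ Ideal.span {x} := by
  intro h
  apply maximalIdeal_notMem_minimalPrimes_span_singleton hdim x
  rw [← h, Ideal.minimalPrimes_eq_subsingleton_self]
  rfl

/-- Each member of a regular system of parameters of length two is prime. -/
lemma isPrime_span_singleton_of_maximalIdeal_eq (hdim : ringKrullDim R = 2) {x y : R}
    (hxy : IsLocalRing.maximalIdeal R = Ideal.span {x, y}) : (Ideal.span {x}).IsPrime := by
  have hx : Ideal.span {x} ≤ IsLocalRing.maximalIdeal R := by
    rw [hxy]
    exact Ideal.span_mono (by simp)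
  obtain ⟨P, hP, hPm⟩ := Ideal.exists_minimalPrimes_le hx
  have hPp : P.IsPrime := hP.1.1
  have hxP : Ideal.span {x} ≤ P := hP.1.2
  have hyP : y ∉ P := by
    intro hy
    apply maximalIdeal_notMem_minimalPrimes_span_singleton hdim x
    have : P = IsLocalRing.maximalIdeal R := by
      refine le_antisymm hPm ?_
      rw [hxy, Ideal.span_le]
      rintro z (rfl | rfl)
      · exact hxP (Ideal.mem_span_singleton_self _)
      · exact hy
    rwa [← this]
  have hle : P ≤ Ideal.span {x} := by
    refine Submodule.le_of_le_smul_of_le_jacobson_bot (I := IsLocalRing.maximalIdeal R)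
      (IsNoetherian.noetherian P) (IsLocalRing.maximalIdeal_le_jacobson _) ?_
    intro p hp
    have hpm := hPm hp
    rw [hxy, Ideal.mem_span_pair] at hpm
    obtain ⟨r, s, rfl⟩ := hpm
    have hxr : r * x ∈ Ideal.span {x} := Ideal.mul_mem_left _ _ (Ideal.mem_span_singleton_self x)
    have hsP : s ∈ P := by
      have : s * y ∈ P := by simpa using P.sub_mem hp (hxP hxr)
      exact (hPp.mem_or_mem this).resolve_right hyP
    refine Submodule.add_mem_sup hxr ?_
    rw [mul_comm]
    refine Submodule.smul_mem_smul ?_ hsP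
    rw [hxy]
    exact Ideal.subset_span (by simp)
  rwa [le_antisymm hxP hle]

lemma isDomain_of_prime_lt_span_singleton {x : R} (hx : (Ideal.span {x}).IsPrime)
    {Q : Ideal R} (hQ : Q.IsPrime) (hlt : Q < Ideal.span {x}) : IsDomain R := by
  have hxQ : x ∉ Q := fun h => hlt.not_ge ((Ideal.span_singleton_le_iff_mem _).2 h)
  have hbot : Q = ⊥ := by
    refine Submodule.eq_bot_of_le_smul_of_le_jacobson_bot (Ideal.span {x}) Q
      (IsNoetherian.noetherian Q) ?_ ?_
    · intro q hq
      obtain ⟨c, rfl⟩ := Ideal.mem_span_singleton.1 (hlt.le hq)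
      exact Submodule.smul_mem_smul (Ideal.mem_span_singleton_self x)
        ((hQ.mem_or_mem hq).resolve_left hxQ)
    · exact (IsLocalRing.le_maximalIdeal hx.ne_top).trans (IsLocalRing.maximalIdeal_le_jacobson _)
  subst hbot
  exact IsDomain.of_bot_isPrime R

lemma isDomain_of_maximalIdeal_eq_span_pair [Algebra ℂ R] (hdim : ringKrullDim R = 2) {a b : R}
    (hab : IsLocalRing.maximalIdeal R = Ideal.span {a, b}) : IsDomain R := by
  by_contra hdom
  have hgen (c : ℂ) :
      IsLocalRing.maximalIdeal R = Ideal.span {a + algebraMap ℂ R c * b, b} := by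
    rw [hab]
    exact (Ideal.span_pair_add_mul_right _ _ _).symm
  have hmin (c : ℂ) : Ideal.span {a + algebraMap ℂ R c * b} ∈ minimalPrimes R := by
    have hp := isPrime_span_singleton_of_maximalIdeal_eq hdim (hgen c)
    obtain ⟨Q, hQ, hle⟩ := Ideal.exists_minimalPrimes_le (bot_le (a := Ideal.span
      {a + algebraMap ℂ R c * b}))
    rcases hle.lt_or_eq with hlt | heq
    · exact absurd (isDomain_of_prime_lt_span_singleton hp hQ.1.1 hlt) hdom
    · rwa [← heq]
  have : Finite (minimalPrimes R) := (minimalPrimes.finite_of_isNoetherianRing R).to_subtype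
  obtain ⟨c, d, hcd, h⟩ := Finite.exists_ne_map_eq_of_infinite
    (fun c : ℂ => (⟨_, hmin c⟩ : minimalPrimes R))
  have h' : Ideal.span {a + algebraMap ℂ R c * b} = Ideal.span {a + algebraMap ℂ R d * b} :=
    congrArg Subtype.val h
  have hb : b ∈ Ideal.span {a + algebraMap ℂ R c * b} := by
    have h1 := Ideal.mem_span_singleton_self (a + algebraMap ℂ R c * b)
    have h2 := Ideal.mem_span_singleton_self (a + algebraMap ℂ R d * b)
    rw [← h'] at h2
    have h3 := Ideal.mul_mem_left _ (algebraMap ℂ R (c - d)⁻¹) (Ideal.sub_mem _ h1 h2)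
    have h4 : algebraMap ℂ R (c - d)⁻¹ * (algebraMap ℂ R c - algebraMap ℂ R d) = 1 := by
      rw [← map_sub, ← map_mul, inv_mul_cancel₀ (sub_ne_zero.2 hcd), map_one]
    convert h3 using 1
    linear_combination -b * h4
  apply maximalIdeal_ne_span_singleton hdim (a + algebraMap ℂ R c * b)
  rw [hgen c]
  refine le_antisymm (Ideal.span_le.2 ?_) (Ideal.span_mono (by simp))
  rintro z (rfl | rfl)
  · exact Ideal.mem_span_singleton_self _
  · exact hb

/-- The Koszul complex of a regular system of parameters of length two is exact in the middle. -/
lemma exists_eq_mul_of_mul_add_mul_eq_zero [Algebra ℂ R] (hdim : ringKrullDim R = 2) {a b : R}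
    (hab : IsLocalRing.maximalIdeal R = Ideal.span {a, b}) {r s : R} (h : r * a + s * b = 0) :
    ∃ w, r = w * b ∧ s = -(w * a) := by
  have := isDomain_of_maximalIdeal_eq_span_pair hdim hab
  have hp := isPrime_span_singleton_of_maximalIdeal_eq hdim hab
  have hb : b ∉ Ideal.span {a} := by
    intro hb
    apply maximalIdeal_ne_span_singleton hdim a
    rw [hab]
    refine le_antisymm (Ideal.span_le.2 ?_) (Ideal.span_mono (by simp))
    rintro z (rfl | rfl)
    · exact Ideal.mem_span_singleton_self _
    · exact hb
  have ha : a ≠ 0 := by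
    rintro rfl
    apply maximalIdeal_ne_span_singleton hdim b
    rw [hab, Ideal.span_insert_zero]
  have hsb : s * b ∈ Ideal.span {a} :=
    Ideal.mem_span_singleton.2 ⟨-r, by linear_combination h⟩
  obtain ⟨w, rfl⟩ := Ideal.mem_span_singleton.1 ((hp.mem_or_mem hsb).resolve_right hb)
  refine ⟨-w, ?_, by ring⟩
  apply mul_left_cancel₀ ha
  linear_combination h

end RegularParameters

section DualNumbers

variable {R : Type*} [CommRing R]

lemma tn_two_mul_self : tn R 2 * tn R 2 = 0 := by
  rw [← pow_two, tn, ← map_pow]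
  exact Ideal.Quotient.eq_zero_iff_mem.2 (Ideal.mem_span_singleton_self _)

@[simp] lemma ct2_tn : ct2 R (tn R 2) = 0 := by
  simp [ct2, ct, tn]

@[simp] lemma ct2_algebraMap (r : R) : ct2 R (algebraMap R (Rn R 2) r) = r := by
  change ct2 R (Ideal.Quotient.mk _ (C r)) = r
  simp [ct2, ct]

lemma exists_eq_tn_mul_of_ct2_eq_zero {x : Rn R 2} (hx : ct2 R x = 0) : ∃ y, x = tn R 2 * y := by
  obtain ⟨p, rfl⟩ := Ideal.Quotient.mk_surjective x
  have hp : p.coeff 0 = 0 := by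
    simpa [ct2, ct, coeff_zero_eq_eval_zero] using hx
  obtain ⟨q, rfl⟩ := X_dvd_iff.2 hp
  exact ⟨Ideal.Quotient.mk _ q, by rw [tn, map_mul]⟩

lemma tn_mul_eq_zero_iff {x : Rn R 2} : tn R 2 * x = 0 ↔ ct2 R x = 0 := by
  constructor
  · intro hx
    obtain ⟨p, rfl⟩ := Ideal.Quotient.mk_surjective x
    rw [tn, ← map_mul, Ideal.Quotient.eq_zero_iff_mem, Ideal.mem_span_singleton] at hx
    have := X_pow_dvd_iff.1 hx 1 (by norm_num)
    rw [coeff_X_mul] at this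
    simpa [ct2, ct, coeff_zero_eq_eval_zero] using this
  · intro hx
    obtain ⟨y, rfl⟩ := exists_eq_tn_mul_of_ct2_eq_zero hx
    rw [← mul_assoc, tn_two_mul_self, zero_mul]

lemma tn_mul_eq_tn_mul_iff {x y : Rn R 2} : tn R 2 * x = tn R 2 * y ↔ ct2 R x = ct2 R y := by
  rw [← sub_eq_zero, ← mul_sub, tn_mul_eq_zero_iff, map_sub, sub_eq_zero]

variable {M : Type*} [AddCommGroup M] [Module (Rn R 2) M]

lemma mem_tMi_one {m : M} : m ∈ tMi R 2 M 1 ↔ ∃ m', m = tn R 2 • m' := by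
  simp [tMi, eq_comm]

lemma mem_kt_one {m : M} : m ∈ kt R 2 M 1 ↔ tn R 2 • m = 0 := by
  simp [kt]

variable (ψ : M →ₛₗ[ct2 R] R) {e f : M} {u v : Rn R 2}

/-- If the relations between `ψ e` and `ψ f` are generated by the Koszul relation, then the
relations between `e` and `f` are generated by any lift of that relation. -/
lemma smul_add_smul_eq_zero_iff (hψ : ∀ m, ψ m = 0 ↔ tn R 2 • m = 0)
    (hK : ∀ r s, r * ψ e + s * ψ f = 0 → ∃ w, r = w * ψ f ∧ s = -(w * ψ e))
    (hu : ct2 R u = ψ e) (hv : ct2 R v = ψ f) (huv : v • e = u • f) (p q : Rn R 2) :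
    p • e + q • f = 0 ↔ ∃ w, p = w * v ∧ q = -(w * u) := by
  constructor
  · intro h
    have key (p q : Rn R 2) (h : ψ (p • e + q • f) = 0) :
        ∃ w p' q', p = w * v + tn R 2 * p' ∧ q = -(w * u) + tn R 2 * q' := by
      simp only [map_add, map_smulₛₗ, smul_eq_mul] at h
      obtain ⟨w, h1, h2⟩ := hK _ _ h
      obtain ⟨p', hp'⟩ := exists_eq_tn_mul_of_ct2_eq_zero
        (x := p - algebraMap R (Rn R 2) w * v) (by simp [h1, hv])
      obtain ⟨q', hq'⟩ := exists_eq_tn_mul_of_ct2_eq_zero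
        (x := q + algebraMap R (Rn R 2) w * u) (by simp [h2, hu])
      exact ⟨_, p', q', sub_eq_iff_eq_add'.1 hp', by linear_combination (exp := 1) hq'⟩
    obtain ⟨w, p', q', rfl, rfl⟩ := key p q (by rw [h, map_zero])
    have h' : ψ (p' • e + q' • f) = 0 := by
      rw [hψ, ← h]
      linear_combination (norm := module) (-w) • huv
    obtain ⟨w', p'', q'', rfl, rfl⟩ := key p' q' h'
    refine ⟨w + tn R 2 * w', ?_, ?_⟩
    · linear_combination p'' * tn_two_mul_self (R := R)
    · linear_combination q'' * tn_two_mul_self (R := R)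
  · rintro ⟨w, rfl, rfl⟩
    rw [neg_smul, mul_smul, mul_smul, huv, add_neg_cancel]

lemma exists_smul_add_smul_eq (hψ : ∀ m, ψ m = 0 → ∃ m', m = tn R 2 • m')
    (hspan : ∀ m, ∃ r s, r * ψ e + s * ψ f = ψ m) (m : M) :
    ∃ p q : Rn R 2, p • e + q • f = m := by
  have key (m : M) : ∃ (p q : Rn R 2) (m' : M), m = p • e + q • f + tn R 2 • m' := by
    obtain ⟨r, s, h⟩ := hspan m
    obtain ⟨m', hm'⟩ := hψ
      (m - (algebraMap R (Rn R 2) r • e + algebraMap R (Rn R 2) s • f))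
      (by simp only [map_sub, map_add, map_smulₛₗ, smul_eq_mul, ct2_algebraMap, h, sub_self])
    exact ⟨_, _, m', by rw [← hm', add_sub_cancel]⟩
  obtain ⟨p, q, m', rfl⟩ := key m
  obtain ⟨p', q', m₂, rfl⟩ := key m'
  refine ⟨p + tn R 2 * p', q + tn R 2 * q', ?_⟩
  have h0 : tn R 2 • tn R 2 • m₂ = 0 := by
    rw [smul_smul, tn_two_mul_self]
    exact zero_smul (Rn R 2) m₂
  simp only [smul_add, h0, add_smul, mul_smul]
  abel

/-- Two modules on two generators with the same relations are isomorphic. -/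
lemma nonempty_linearEquiv_of_same_relations {A M N : Type*} [CommRing A] [AddCommGroup M]
    [Module A M] [AddCommGroup N] [Module A N] {e f : M} {e' f' : N}
    (hM : ∀ m, ∃ p q : A, p • e + q • f = m) (hN : ∀ n, ∃ p q : A, p • e' + q • f' = n)
    (h : ∀ p q : A, p • e + q • f = 0 ↔ p • e' + q • f' = 0) : Nonempty (M ≃ₗ[A] N) := by
  let g := (LinearMap.toSpanSingleton A M e).coprod (LinearMap.toSpanSingleton A M f)
  let gN := (LinearMap.toSpanSingleton A N e').coprod (LinearMap.toSpanSingleton A N f')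
  have hg : Function.Surjective g := fun m => by
    obtain ⟨p, q, rfl⟩ := hM m
    exact ⟨(p, q), by simp [g]⟩
  have hgN : Function.Surjective gN := fun m => by
    obtain ⟨p, q, rfl⟩ := hN m
    exact ⟨(p, q), by simp [gN]⟩
  have hker : LinearMap.ker g = LinearMap.ker gN := by
    ext ⟨p, q⟩
    simpa [g, gN] using h p q
  exact ⟨(g.quotKerEquivOfSurjective hg).symm ≪≫ₗ Submodule.quotEquivOfEq _ _ hker ≪≫ₗ
    gN.quotKerEquivOfSurjective hgN⟩

/-- The constant term map restricted to an ideal of `R[2]`. -/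
def ct2Ideal (J : Ideal (Rn R 2)) : J →ₛₗ[ct2 R] R where
  toFun x := ct2 R x
  map_add' x y := by simp
  map_smul' x y := by simp

@[simp] lemma ct2Ideal_apply (J : Ideal (Rn R 2)) (x : J) : ct2Ideal J x = ct2 R x := rfl

lemma ct2Ideal_eq_zero_iff (J : Ideal (Rn R 2)) (x : J) :
    ct2Ideal J x = 0 ↔ tn R 2 • x = 0 := by
  rw [ct2Ideal_apply, ← tn_mul_eq_zero_iff, Subtype.ext_iff]
  rfl

end DualNumbers

section Ideals

variable {R : Type*} [CommRing R] {u v : Rn R 2}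

lemma tMi_eq_kt_span_pair
    (hK : ∀ r s, r * ct2 R u + s * ct2 R v = 0 → ∃ w, r = w * ct2 R v ∧ s = -(w * ct2 R u)) :
    tMi R 2 (Ideal.span {u, v} : Ideal (Rn R 2)) 1 = kt R 2 (Ideal.span {u, v}) 1 := by
  have huv {z : Rn R 2} (r s : R) (hz : ct2 R z = r * ct2 R u + s * ct2 R v) :
      ∃ y ∈ Ideal.span {u, v}, tn R 2 * z = tn R 2 * y :=
    ⟨algebraMap R _ r * u + algebraMap R _ s * v, Ideal.mem_span_pair.2 ⟨_, _, rfl⟩,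
      tn_mul_eq_tn_mul_iff.2 (by simp [hz])⟩
  ext ⟨x, hx⟩
  rw [mem_tMi_one, mem_kt_one, ← ct2Ideal_eq_zero_iff, ct2Ideal_apply]
  constructor
  · rintro ⟨y, hy⟩
    rw [hy]
    simp
  · intro h0
    obtain ⟨p, q, rfl⟩ := Ideal.mem_span_pair.1 hx
    obtain ⟨w, h1, h2⟩ := hK (ct2 R p) (ct2 R q) (by simpa using h0)
    obtain ⟨p', hp'⟩ := exists_eq_tn_mul_of_ct2_eq_zero
      (x := p - algebraMap R (Rn R 2) w * v) (by simp [h1])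
    obtain ⟨q', hq'⟩ := exists_eq_tn_mul_of_ct2_eq_zero
      (x := q + algebraMap R (Rn R 2) w * u) (by simp [h2])
    obtain ⟨y, hy, hty⟩ := huv (z := p' * u + q' * v) (ct2 R p') (ct2 R q') (by simp)
    refine ⟨⟨y, hy⟩, Subtype.ext ?_⟩
    change p * u + q * v = tn R 2 * y
    linear_combination u * hp' + v * hq' + hty

variable [IsLocalRing R]

lemma nonempty_quotient_tMi_linearEquiv_maximalIdeal
    (hm : IsLocalRing.maximalIdeal R = Ideal.span {ct2 R u, ct2 R v})
    (hbal : tMi R 2 (Ideal.span {u, v} : Ideal (Rn R 2)) 1 = kt R 2 (Ideal.span {u, v}) 1) :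
    letI : Module R (↥(Ideal.span {u, v} : Ideal (Rn R 2)) ⧸
        tMi R 2 ↥(Ideal.span {u, v} : Ideal (Rn R 2)) 1) :=
      Module.compHom _ (algebraMap R (Rn R 2))
    Nonempty ((↥(Ideal.span {u, v} : Ideal (Rn R 2)) ⧸
      tMi R 2 ↥(Ideal.span {u, v} : Ideal (Rn R 2)) 1) ≃ₗ[R] ↥(IsLocalRing.maximalIdeal R)) := by
  set J : Ideal (Rn R 2) := Ideal.span {u, v} with hJ
  let : Module R (↥J ⧸ tMi R 2 ↥J 1) := Module.compHom _ (algebraMap R (Rn R 2))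
  have hker (x : J) : x ∈ tMi R 2 J 1 ↔ ct2Ideal J x = 0 := by
    rw [hbal, mem_kt_one, ct2Ideal_eq_zero_iff]
  have hmem (x : J) : ct2Ideal J x ∈ IsLocalRing.maximalIdeal R := by
    obtain ⟨p, q, h⟩ := Ideal.mem_span_pair.1 x.2
    rw [ct2Ideal_apply, ← h, hm]
    exact Ideal.mem_span_pair.2 ⟨ct2 R p, ct2 R q, by simp⟩
  let g : (↥J ⧸ tMi R 2 ↥J 1) →ₛₗ[ct2 R] R :=
    Submodule.liftQ _ (ct2Ideal J) fun x hx => (hker x).1 hx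
  have hg (x : ↥J ⧸ tMi R 2 ↥J 1) : g x ∈ IsLocalRing.maximalIdeal R := by
    induction x using Submodule.Quotient.induction_on with
    | H x => exact hmem x
  let φ : (↥J ⧸ tMi R 2 ↥J 1) →ₗ[R] ↥(IsLocalRing.maximalIdeal R) :=
    { toFun := fun x => ⟨g x, hg x⟩
      map_add' := fun x y => Subtype.ext (map_add g x y)
      map_smul' := fun r x => Subtype.ext (by
        change g (algebraMap R (Rn R 2) r • x) = r * g x
        rw [map_smulₛₗ, ct2_algebraMap, smul_eq_mul]) }
  refine ⟨LinearEquiv.ofBijective φ ⟨(injective_iff_map_eq_zero φ).2 fun x hx => ?_, ?_⟩⟩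
  · induction x using Submodule.Quotient.induction_on with
    | H x =>
      exact (Submodule.Quotient.mk_eq_zero _).2 ((hker x).2 (congrArg Subtype.val hx))
  · rintro ⟨z, hz⟩
    obtain ⟨r, s, rfl⟩ := Ideal.mem_span_pair.1 (hm ▸ hz)
    refine ⟨Submodule.Quotient.mk ⟨algebraMap R _ r * u + algebraMap R _ s * v,
      Ideal.mem_span_pair.2 ⟨_, _, rfl⟩⟩, Subtype.ext ?_⟩
    change ct2 R (algebraMap R _ r * u + algebraMap R _ s * v) = _
    simp

lemma exists_ideal_linearEquiv_of_balanced {a b : R}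
    (hab : IsLocalRing.maximalIdeal R = Ideal.span {a, b})
    (hK : ∀ r s, r * a + s * b = 0 → ∃ w, r = w * b ∧ s = -(w * a))
    {M : Type*} [AddCommGroup M] [Module (Rn R 2) M] (ψ : M →ₛₗ[ct2 R] R)
    (hψ : ∀ m, ψ m = 0 ↔ tn R 2 • m = 0) (hψ' : ∀ m, ψ m = 0 ↔ ∃ m', m = tn R 2 • m')
    (hrange : ∀ r, r ∈ IsLocalRing.maximalIdeal R ↔ ∃ m, ψ m = r) :
    ∃ J : Ideal (Rn R 2),
      (∃ u v : Rn R 2, J = Ideal.span {u, v} ∧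
        IsLocalRing.maximalIdeal R = Ideal.span {ct2 R u, ct2 R v}) ∧
      Nonempty (M ≃ₗ[Rn R 2] ↥J) := by
  obtain ⟨e, rfl⟩ := (hrange a).1 (hab ▸ Ideal.subset_span (by simp))
  obtain ⟨f, rfl⟩ := (hrange b).1 (hab ▸ Ideal.subset_span (by simp))
  have hM := exists_smul_add_smul_eq ψ (e := e) (f := f) (fun m => (hψ' m).1)
    fun m => Ideal.mem_span_pair.1 (hab ▸ (hrange _).2 ⟨m, rfl⟩)
  obtain ⟨m', hm'⟩ := (hψ' (algebraMap R (Rn R 2) (ψ f) • e - algebraMap R (Rn R 2) (ψ e) • f)).1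
    (by simp [mul_comm])
  obtain ⟨p, q, rfl⟩ := hM m'
  let u := algebraMap R (Rn R 2) (ψ e) + tn R 2 * q
  let v := algebraMap R (Rn R 2) (ψ f) - tn R 2 * p
  have hu : ct2 R u = ψ e := by simp [u]
  have hv : ct2 R v = ψ f := by simp [v]
  have huv : v • e = u • f := by
    simp only [u, v]
    linear_combination (norm := module) hm'
  refine ⟨Ideal.span {u, v}, ⟨u, v, rfl, by rw [hu, hv, hab]⟩, ?_⟩
  let e' : Ideal.span {u, v} := ⟨u, Ideal.subset_span (by simp)⟩
  let f' : Ideal.span {u, v} := ⟨v, Ideal.subset_span (by simp)⟩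
  refine nonempty_linearEquiv_of_same_relations (e := e) (f := f) (e' := e') (f' := f') hM ?_ ?_
  · rintro ⟨x, hx⟩
    obtain ⟨p, q, rfl⟩ := Ideal.mem_span_pair.1 hx
    exact ⟨p, q, rfl⟩
  · intro p q
    rw [smul_add_smul_eq_zero_iff ψ hψ hK hu hv huv,
      smul_add_smul_eq_zero_iff (ct2Ideal _) (ct2Ideal_eq_zero_iff _) (e := e') (f := f')
        (u := u) (v := v) (by simpa [e', f', hu, hv] using hK) rfl rfl
        (Subtype.ext (mul_comm v u))]

end Ideals

/-- Let `R` be a 2-dimensional regular local ring containing `ℂ` with residue field `ℂ`,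
with maximal ideal `𝔪`, `A = R[t]/(t²)`. The balanced finitely generated `A`-modules `M`
with `M/tM ≅ 𝔪` (as `R`-modules) are exactly the `A`-modules isomorphic to ideals `J ⊆ A`
admitting two generators whose images in `R` generate `𝔪`:
every such ideal `J` is balanced with `J/tJ ≅ 𝔪`, and conversely every finitely generated
balanced `A`-module `M` with `M/tM ≅ 𝔪` is isomorphic to such an ideal.
(Balanced for `A = R[2]` means `tM = {m : t m = 0}`, i.e. `tMi R 2 M 1 = kt R 2 M 1`.) -/
theorem balanced_modules_are_ideals
    {R : Type u} [CommRing R] [IsLocalRing R] [IsNoetherianRing R] [Algebra ℂ R]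
    (hdim : ringKrullDim R = 2)
    (hreg : ∃ a b : R, IsLocalRing.maximalIdeal R = Ideal.span {a, b})
    (hres : ∀ r : R, ∃ c : ℂ, r - algebraMap ℂ R c ∈ IsLocalRing.maximalIdeal R) :
    (∀ J : Ideal (Rn R 2),
      (∃ u v : Rn R 2, J = Ideal.span {u, v} ∧
          IsLocalRing.maximalIdeal R = Ideal.span {ct2 R u, ct2 R v}) →
        (tMi R 2 J 1 = kt R 2 J 1 ∧
          (letI : Module R (↥J ⧸ tMi R 2 ↥J 1) :=
            Module.compHom _ (algebraMap R (Rn R 2))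
          Nonempty ((↥J ⧸ tMi R 2 ↥J 1) ≃ₗ[R] ↥(IsLocalRing.maximalIdeal R))))) ∧
    (∀ (M : Type v) [AddCommGroup M] [Module (Rn R 2) M] [Module.Finite (Rn R 2) M],
      tMi R 2 M 1 = kt R 2 M 1 →
      (letI : Module R (M ⧸ tMi R 2 M 1) := Module.compHom _ (algebraMap R (Rn R 2))
       Nonempty ((M ⧸ tMi R 2 M 1) ≃ₗ[R] ↥(IsLocalRing.maximalIdeal R))) →
      ∃ J : Ideal (Rn R 2),
        (∃ u v : Rn R 2, J = Ideal.span {u, v} ∧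
            IsLocalRing.maximalIdeal R = Ideal.span {ct2 R u, ct2 R v}) ∧
        Nonempty (M ≃ₗ[Rn R 2] ↥J)) := by
  obtain ⟨a, b, hab⟩ := hreg
  refine ⟨?_, ?_⟩
  · rintro _ ⟨u, v, rfl, hm⟩
    have hbal := tMi_eq_kt_span_pair (u := u) (v := v)
      fun r s => exists_eq_mul_of_mul_add_mul_eq_zero hdim hm
    exact ⟨hbal, nonempty_quotient_tMi_linearEquiv_maximalIdeal hm hbal⟩
  · intro M _ _ _ hbal hφ
    let : Module R (M ⧸ tMi R 2 M 1) := Module.compHom _ (algebraMap R (Rn R 2))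
    obtain ⟨φ⟩ := hφ
    have htQ (x : M ⧸ tMi R 2 M 1) : tn R 2 • x = 0 := by
      induction x using Submodule.Quotient.induction_on with
      | H x => exact (Submodule.Quotient.mk_eq_zero _).2 (mem_tMi_one.2 ⟨x, rfl⟩)
    have hsmul (x : Rn R 2) (y : M ⧸ tMi R 2 M 1) : x • y = ct2 R x • y := by
      obtain ⟨z, hz⟩ := exists_eq_tn_mul_of_ct2_eq_zero
        (x := x - algebraMap R (Rn R 2) (ct2 R x)) (by simp)
      change x • y = algebraMap R (Rn R 2) (ct2 R x) • y
      rw [← sub_eq_zero]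
      refine (sub_smul x (algebraMap R (Rn R 2) (ct2 R x)) y).symm.trans ?_
      rw [hz, mul_smul, htQ]
    let ψ : M →ₛₗ[ct2 R] R :=
      { toFun := fun m => φ (Submodule.Quotient.mk m)
        map_add' := fun x y => by simp
        map_smul' := fun x y => by
          rw [Submodule.Quotient.mk_smul, hsmul, map_smul]
          rfl }
    have hψ (m : M) : ψ m = 0 ↔ m ∈ tMi R 2 M 1 := by
      change ((φ (Submodule.Quotient.mk m) : IsLocalRing.maximalIdeal R) : R) = 0 ↔ _
      rw [ZeroMemClass.coe_eq_zero, LinearEquiv.map_eq_zero_iff, Submodule.Quotient.mk_eq_zero]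
    refine exists_ideal_linearEquiv_of_balanced hab
      (fun r s => exists_eq_mul_of_mul_add_mul_eq_zero hdim hab) ψ
      (fun m => by rw [hψ, hbal, mem_kt_one]) (fun m => by rw [hψ, mem_tMi_one]) fun r => ?_
    constructor
    · intro hr
      obtain ⟨m, hm⟩ := Submodule.Quotient.mk_surjective _ (φ.symm ⟨r, hr⟩)
      refine ⟨m, ?_⟩
      change ((φ (Submodule.Quotient.mk m) : IsLocalRing.maximalIdeal R) : R) = r
      rw [hm, LinearEquiv.apply_symm_apply]
    · rintro ⟨m, rfl⟩
      exact (φ (Submodule.Quotient.mk m)).2
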